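/- Let P be a lattice polytope in R^3 of lattice width one enclosed between the planes x = 0 and x = 1, with B_0 = P ∩ {x=0} and B_1 = P ∩ {x=1} regarded as lattice polygons in the (y,z)-plane. Suppose that, up to a lattice translation, B_1 is contained in the convex hull of the interior lattice points of B_0. Then ls_Delta(P) = ls_{Delta_2}(B_0). -/

import Mathlib

open scoped BigOperators

/-- Width of a set `P ⊆ ℝ^d` in direction `h`. -/
noncomputable def width {d : ℕ} (P : Set (Fin d → ℝ)) (h : Fin d → ℝ) : ℝ :=
  sSup ((fun x => ∑ i, h i * x i) '' P) - sInf ((fun x => ∑ i, h i * x i) '' P)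

/-- Cast an integer vector to a real vector. -/
def zcast {d : ℕ} (h : Fin d → ℤ) : Fin d → ℝ := fun i => (h i : ℝ)

/-- A lattice polytope: the convex hull of a nonempty finite set of integer points. -/
def IsLatticePolytope {d : ℕ} (P : Set (Fin d → ℝ)) : Prop :=
  ∃ V : Finset (Fin d → ℝ), V.Nonempty ∧ (∀ v ∈ V, ∀ i, ∃ n : ℤ, v i = (n : ℝ)) ∧
    P = convexHull ℝ (V : Set (Fin d → ℝ))

/-- `l₁` of a subset of `ℝ³`. -/
noncomputable def lone3 (P : Set (Fin 3 → ℝ)) : ℝ :=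
  sSup ((fun x => x 0 + x 1 + x 2) '' P) - sInf ((fun x => x 0) '' P) -
    sInf ((fun x => x 1) '' P) - sInf ((fun x => x 2) '' P)

/-- `l₁` of a subset of `ℝ²`. -/
noncomputable def lone2 (P : Set (Fin 2 → ℝ)) : ℝ :=
  sSup ((fun x => x 0 + x 1) '' P) - sInf ((fun x => x 0) '' P) - sInf ((fun x => x 1) '' P)

/-- Lattice size of a subset of `ℝ³` with respect to the standard simplex. -/
noncomputable def lsDelta3 (P : Set (Fin 3 → ℝ)) : ℝ :=
  sInf {r : ℝ | ∃ A : Matrix (Fin 3) (Fin 3) ℤ, IsUnit A.det ∧ ∃ v : Fin 3 → ℤ,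
    r = lone3 ((fun x => Matrix.mulVec (A.map (Int.cast : ℤ → ℝ)) x + zcast v) '' P)}

/-- Lattice size of a subset of `ℝ²` with respect to the standard simplex. -/
noncomputable def lsDelta2 (P : Set (Fin 2 → ℝ)) : ℝ :=
  sInf {r : ℝ | ∃ A : Matrix (Fin 2) (Fin 2) ℤ, IsUnit A.det ∧ ∃ v : Fin 2 → ℤ,
    r = lone2 ((fun x => Matrix.mulVec (A.map (Int.cast : ℤ → ℝ)) x + zcast v) '' P)}

/-- The support function of `Q` evaluated at the integer covector `(a, b)`. -/
noncomputable def latticeSupport (Q : Set (Fin 2 → ℝ)) (a b : ℤ) : ℝ :=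
  sSup ((fun y : Fin 2 → ℝ => (a : ℝ) * y 0 + (b : ℝ) * y 1) '' Q)

lemma IsCompact.bddAbove_image_of_continuous {X : Type*} [TopologicalSpace X] {Q : Set X}
    (hQ : IsCompact Q) {f : X → ℝ} (hf : Continuous f) : BddAbove (f '' Q) :=
  (hQ.image hf).bddAbove

lemma IsCompact.bddBelow_image_of_continuous {X : Type*} [TopologicalSpace X] {Q : Set X}
    (hQ : IsCompact Q) {f : X → ℝ} (hf : Continuous f) : BddBelow (f '' Q) :=
  (hQ.image hf).bddBelow

lemma le_latticeSupport {Q : Set (Fin 2 → ℝ)} (hQ : IsCompact Q) (a b : ℤ) {y : Fin 2 → ℝ}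
    (hy : y ∈ Q) : (a : ℝ) * y 0 + (b : ℝ) * y 1 ≤ latticeSupport Q a b :=
  le_csSup (hQ.bddAbove_image_of_continuous (by fun_prop))
    (Set.mem_image_of_mem (fun y : Fin 2 → ℝ => (a : ℝ) * y 0 + (b : ℝ) * y 1) hy)

lemma latticeSupport_le {Q : Set (Fin 2 → ℝ)} (hQ : Q.Nonempty) {a b : ℤ} {c : ℝ}
    (h : ∀ y ∈ Q, (a : ℝ) * y 0 + (b : ℝ) * y 1 ≤ c) : latticeSupport Q a b ≤ c := by
  refine csSup_le (hQ.image _) ?_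
  rintro _ ⟨y, hy, rfl⟩
  exact h y hy

lemma latticeSupport_sublinear {Q : Set (Fin 2 → ℝ)} (hQ : IsCompact Q) (hne : Q.Nonempty)
    (D m n a b c d e f : ℤ) (hD : 0 < D) (hm : 0 ≤ m) (hn : 0 ≤ n)
    (h0 : D * a = m * c + n * e) (h1 : D * b = m * d + n * f) :
    (D : ℝ) * latticeSupport Q a b ≤ m * latticeSupport Q c d + n * latticeSupport Q e f := by
  have hD' : (0 : ℝ) < D := by exact_mod_cast hD
  have hm' : (0 : ℝ) ≤ m := by exact_mod_cast hm
  have hn' : (0 : ℝ) ≤ n := by exact_mod_cast hn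
  have h0' : (D : ℝ) * a = m * c + n * e := by exact_mod_cast h0
  have h1' : (D : ℝ) * b = m * d + n * f := by exact_mod_cast h1
  rw [mul_comm, ← le_div_iff₀ hD']
  refine latticeSupport_le hne fun y hy => ?_
  rw [le_div_iff₀ hD']
  have e1 := mul_le_mul_of_nonneg_left (le_latticeSupport hQ c d hy) hm'
  have e2 := mul_le_mul_of_nonneg_left (le_latticeSupport hQ e f hy) hn'
  have e3 : ((a : ℝ) * y 0 + b * y 1) * D = m * (c * y 0 + d * y 1) + n * (e * y 0 + f * y 1) := by
    linear_combination y 0 * h0' + y 1 * h1'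
  linarith

/-- A lattice triangle `0, u, v` whose normalized area is at least two contains a lattice point
which is not a vertex. -/
lemma exists_lattice_point_in_triangle (u0 u1 v0 v1 D ε : ℤ) (hε : ε * ε = 1)
    (hd : ε * (u0 * v1 - u1 * v0) = D) (hD : 1 < D) :
    ∃ p0 p1 i j : ℤ, D * p0 = i * u0 + j * v0 ∧ D * p1 = i * u1 + j * v1 ∧ 0 ≤ i ∧ 0 ≤ j ∧
      i < D ∧ j < D ∧ 0 < i + j ∧ i + j ≤ D := by
  have hD0 : 0 < D := by linarith
  have reduce : ∀ w0 w1 i j : ℤ, D * w0 = i * u0 + j * v0 → D * w1 = i * u1 + j * v1 →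
      ¬ (D ∣ i ∧ D ∣ j) →
      ∃ p0 p1 i j : ℤ, D * p0 = i * u0 + j * v0 ∧ D * p1 = i * u1 + j * v1 ∧ 0 ≤ i ∧ 0 ≤ j ∧
        i < D ∧ j < D ∧ 0 < i + j ∧ i + j ≤ D := by
    intro w0 w1 i j h0 h1 hij
    have ei := Int.emod_add_mul_ediv i D
    have ej := Int.emod_add_mul_ediv j D
    have ni := Int.emod_nonneg i hD0.ne'
    have nj := Int.emod_nonneg j hD0.ne'
    have li := Int.emod_lt_of_pos i hD0
    have lj := Int.emod_lt_of_pos j hD0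
    have hpos : 0 < i % D + j % D := by
      by_contra hcon
      exact hij ⟨Int.dvd_of_emod_eq_zero (by omega), Int.dvd_of_emod_eq_zero (by omega)⟩
    generalize i % D = r at *
    generalize j % D = s at *
    generalize i / D = q at *
    generalize j / D = t at *
    by_cases hle : r + s ≤ D
    · exact ⟨w0 - q * u0 - t * v0, w1 - q * u1 - t * v1, r, s,
        by subst ei ej; linear_combination h0, by subst ei ej; linear_combination h1,
        ni, nj, li, lj, hpos, hle⟩
    · exact ⟨u0 + v0 - (w0 - q * u0 - t * v0), u1 + v1 - (w1 - q * u1 - t * v1), D - r, D - s,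
        by subst ei ej; linear_combination -h0, by subst ei ej; linear_combination -h1,
        by omega, by omega, by omega, by omega, by omega, by omega⟩
  by_cases hu : D ∣ ε * v1 ∧ D ∣ -(ε * u1)
  · by_cases hv : D ∣ -(ε * v0) ∧ D ∣ ε * u0
    · exfalso
      obtain ⟨⟨a, ha⟩, ⟨b, hb⟩⟩ := hu
      obtain ⟨⟨c, hc⟩, ⟨d, hd'⟩⟩ := hv
      have key : D * (ε * (d * a - b * c) * D) = D * 1 := by
        linear_combination hd - ε * (ε * v1) * hd' - ε * (D * d) * ha
          + ε * (-(ε * v0)) * hb + ε * (D * b) * hc + ε * (u0 * v1 - u1 * v0) * hε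
      have h1 := mul_left_cancel₀ hD0.ne' key
      have : D ∣ 1 := ⟨ε * (d * a - b * c), by linear_combination -h1⟩
      have := Int.le_of_dvd one_pos this
      linarith
    · exact reduce 0 1 _ _ (by ring) (by linear_combination -hd) hv
  · exact reduce 1 0 _ _ (by linear_combination -hd) (by ring) hu

/-- For a sublinear function `h`, the sum of `h` over the edge vectors of a nondegenerate lattice
triangle dominates the same sum over some unimodular lattice triangle. -/
lemma exists_unimodular_triangle_le (h : ℤ → ℤ → ℝ)
    (hh : ∀ D m n a b c d e f : ℤ, 0 < D → 0 ≤ m → 0 ≤ n → D * a = m * c + n * e →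
      D * b = m * d + n * f → (D : ℝ) * h a b ≤ m * h c d + n * h e f)
    (N : ℕ) : ∀ u0 u1 v0 v1 : ℤ, u0 * v1 - u1 * v0 ≠ 0 → (u0 * v1 - u1 * v0).natAbs ≤ N →
      ∃ p0 p1 q0 q1 : ℤ, IsUnit (p0 * q1 - p1 * q0) ∧
        h p0 p1 + h (q0 - p0) (q1 - p1) + h (-q0) (-q1) ≤
          h u0 u1 + h (v0 - u0) (v1 - u1) + h (-v0) (-v1) := by
  induction N with
  | zero => intro u0 u1 v0 v1 h0 h1; omega
  | succ N ih =>
    intro u0 u1 v0 v1 hne hN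
    obtain ⟨ε, hε, hε'⟩ : ∃ ε : ℤ, ε * ε = 1 ∧
        ε * (u0 * v1 - u1 * v0) = ((u0 * v1 - u1 * v0).natAbs : ℤ) := by
      rcases le_total 0 (u0 * v1 - u1 * v0) with hs | hs
      · exact ⟨1, by norm_num, by omega⟩
      · exact ⟨-1, by norm_num, by omega⟩
    by_cases hone : (u0 * v1 - u1 * v0).natAbs = 1
    · exact ⟨u0, u1, v0, v1, Int.isUnit_iff_natAbs_eq.2 hone, le_rfl⟩
    obtain ⟨D, hD⟩ : ∃ D : ℤ, D = ((u0 * v1 - u1 * v0).natAbs : ℤ) := ⟨_, rfl⟩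
    rw [← hD] at hε'
    have hD1 : 1 < D := by omega
    have hD0 : 0 < D := by omega
    have hDR : (0 : ℝ) < D := by exact_mod_cast hD0
    obtain ⟨p0, p1, i, j, e0, e1, hi, hj, hiD, hjD, hpos, hle⟩ :=
      exists_lattice_point_in_triangle u0 u1 v0 v1 D ε hε hε' hD1
    have hcases : 0 < i ∨ 0 < j := by omega
    rcases hcases with hi0 | hj0
    · have hdet : p0 * v1 - p1 * v0 = ε * i := by
        apply mul_left_cancel₀ hD0.ne'
        linear_combination v1 * e0 - v0 * e1 + ε * i * hε' - i * (u0 * v1 - u1 * v0) * hε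
      have habs : (p0 * v1 - p1 * v0).natAbs = i.natAbs := by
        rcases Int.isUnit_iff.1 (IsUnit.of_mul_eq_one _ hε) with rfl | rfl <;> omega
      obtain ⟨a, b, c, d, hu, hG⟩ := ih p0 p1 v0 v1 (by omega) (by omega)
      refine ⟨a, b, c, d, hu, hG.trans ?_⟩
      have k1 := hh D (i + j) j p0 p1 u0 u1 (v0 - u0) (v1 - u1) hD0 (by omega) hj
        (by linear_combination e0) (by linear_combination e1)
      have k2 := hh D (D - j) (D - i - j) (v0 - p0) (v1 - p1) (v0 - u0) (v1 - u1) u0 u1 hD0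
        (by omega) (by omega) (by linear_combination -e0) (by linear_combination -e1)
      push_cast at k1 k2
      have := le_of_mul_le_mul_left (a := (D : ℝ)) (b := h p0 p1 + h (v0 - p0) (v1 - p1))
        (c := h u0 u1 + h (v0 - u0) (v1 - u1)) (by linarith) hDR
      linarith
    · have hdet : u0 * p1 - u1 * p0 = ε * j := by
        apply mul_left_cancel₀ hD0.ne'
        linear_combination u0 * e1 - u1 * e0 + ε * j * hε' - j * (u0 * v1 - u1 * v0) * hε
      have habs : (u0 * p1 - u1 * p0).natAbs = j.natAbs := by
        rcases Int.isUnit_iff.1 (IsUnit.of_mul_eq_one _ hε) with rfl | rfl <;> omega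
      obtain ⟨a, b, c, d, hu, hG⟩ := ih u0 u1 p0 p1 (by omega) (by omega)
      refine ⟨a, b, c, d, hu, hG.trans ?_⟩
      have k1 := hh D (D - i) (D - i - j) (p0 - u0) (p1 - u1) (v0 - u0) (v1 - u1) (-v0) (-v1) hD0
        (by omega) (by omega) (by linear_combination e0) (by linear_combination e1)
      have k2 := hh D i (i + j) (-p0) (-p1) (v0 - u0) (v1 - u1) (-v0) (-v1) hD0
        (by omega) (by omega) (by linear_combination -e0) (by linear_combination -e1)
      push_cast at k1 k2
      have := le_of_mul_le_mul_left (a := (D : ℝ)) (b := h (p0 - u0) (p1 - u1) + h (-p0) (-p1))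
        (c := h (v0 - u0) (v1 - u1) + h (-v0) (-v1)) (by linarith) hDR
      linarith

lemma lone2_le {S : Set (Fin 2 → ℝ)} (hS : S.Nonempty) {M m0 m1 : ℝ}
    (hM : ∀ x ∈ S, x 0 + x 1 ≤ M) (hm0 : ∀ x ∈ S, m0 ≤ x 0) (hm1 : ∀ x ∈ S, m1 ≤ x 1) :
    lone2 S ≤ M - m0 - m1 := by
  have a := csSup_le (hS.image fun x => x 0 + x 1) (Set.forall_mem_image.2 hM)
  have b := le_csInf (hS.image fun x => x 0) (Set.forall_mem_image.2 hm0)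
  have c := le_csInf (hS.image fun x => x 1) (Set.forall_mem_image.2 hm1)
  unfold lone2
  linarith

lemma lone3_le {S : Set (Fin 3 → ℝ)} (hS : S.Nonempty) {M m0 m1 m2 : ℝ}
    (hM : ∀ x ∈ S, x 0 + x 1 + x 2 ≤ M) (hm0 : ∀ x ∈ S, m0 ≤ x 0) (hm1 : ∀ x ∈ S, m1 ≤ x 1)
    (hm2 : ∀ x ∈ S, m2 ≤ x 2) : lone3 S ≤ M - m0 - m1 - m2 := by
  have a := csSup_le (hS.image fun x => x 0 + x 1 + x 2) (Set.forall_mem_image.2 hM)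
  have b := le_csInf (hS.image fun x => x 0) (Set.forall_mem_image.2 hm0)
  have c := le_csInf (hS.image fun x => x 1) (Set.forall_mem_image.2 hm1)
  have d := le_csInf (hS.image fun x => x 2) (Set.forall_mem_image.2 hm2)
  unfold lone3
  linarith

lemma exists_lone2_bounds {S : Set (Fin 2 → ℝ)} (hS : IsCompact S) :
    ∃ M m0 m1 : ℝ, lone2 S = M - m0 - m1 ∧
      ∀ x ∈ S, x 0 + x 1 ≤ M ∧ m0 ≤ x 0 ∧ m1 ≤ x 1 :=
  ⟨_, _, _, rfl, fun x hx =>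
    ⟨le_csSup (hS.bddAbove_image_of_continuous (by fun_prop)) ⟨x, hx, rfl⟩,
      csInf_le (hS.bddBelow_image_of_continuous (by fun_prop)) ⟨x, hx, rfl⟩,
      csInf_le (hS.bddBelow_image_of_continuous (by fun_prop)) ⟨x, hx, rfl⟩⟩⟩

lemma exists_lone3_bounds {S : Set (Fin 3 → ℝ)} (hS : IsCompact S) :
    ∃ M m0 m1 m2 : ℝ, lone3 S = M - m0 - m1 - m2 ∧
      ∀ x ∈ S, x 0 + x 1 + x 2 ≤ M ∧ m0 ≤ x 0 ∧ m1 ≤ x 1 ∧ m2 ≤ x 2 :=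
  ⟨_, _, _, _, rfl, fun x hx =>
    ⟨le_csSup (hS.bddAbove_image_of_continuous (by fun_prop)) ⟨x, hx, rfl⟩,
      csInf_le (hS.bddBelow_image_of_continuous (by fun_prop)) ⟨x, hx, rfl⟩,
      csInf_le (hS.bddBelow_image_of_continuous (by fun_prop)) ⟨x, hx, rfl⟩,
      csInf_le (hS.bddBelow_image_of_continuous (by fun_prop)) ⟨x, hx, rfl⟩⟩⟩

lemma lone2_nonneg {S : Set (Fin 2 → ℝ)} (hS : IsCompact S) (hne : S.Nonempty) : 0 ≤ lone2 S := by
  obtain ⟨M, m0, m1, h, hb⟩ := exists_lone2_bounds hS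
  obtain ⟨x, hx⟩ := hne
  obtain ⟨a, b, c⟩ := hb x hx
  linarith

lemma lone3_nonneg {S : Set (Fin 3 → ℝ)} (hS : IsCompact S) (hne : S.Nonempty) : 0 ≤ lone3 S := by
  obtain ⟨M, m0, m1, m2, h, hb⟩ := exists_lone3_bounds hS
  obtain ⟨x, hx⟩ := hne
  obtain ⟨a, b, c, d⟩ := hb x hx
  linarith

lemma continuous_mulVec_add {d : ℕ} (A : Matrix (Fin d) (Fin d) ℤ) (v : Fin d → ℤ) :
    Continuous fun x : Fin d → ℝ => Matrix.mulVec (A.map (Int.cast : ℤ → ℝ)) x + zcast v := by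
  fun_prop

lemma lsDelta2_le {S : Set (Fin 2 → ℝ)} (hS : IsCompact S) (hne : S.Nonempty)
    (A : Matrix (Fin 2) (Fin 2) ℤ) (hA : IsUnit A.det) (v : Fin 2 → ℤ) :
    lsDelta2 S ≤ lone2 ((fun x => Matrix.mulVec (A.map (Int.cast : ℤ → ℝ)) x + zcast v) '' S) := by
  refine csInf_le ⟨0, ?_⟩ ⟨A, hA, v, rfl⟩
  rintro _ ⟨B, -, w, rfl⟩
  exact lone2_nonneg (hS.image (continuous_mulVec_add B w)) (hne.image _)

lemma lsDelta3_le {S : Set (Fin 3 → ℝ)} (hS : IsCompact S) (hne : S.Nonempty)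
    (A : Matrix (Fin 3) (Fin 3) ℤ) (hA : IsUnit A.det) (v : Fin 3 → ℤ) :
    lsDelta3 S ≤ lone3 ((fun x => Matrix.mulVec (A.map (Int.cast : ℤ → ℝ)) x + zcast v) '' S) := by
  refine csInf_le ⟨0, ?_⟩ ⟨A, hA, v, rfl⟩
  rintro _ ⟨B, -, w, rfl⟩
  exact lone3_nonneg (hS.image (continuous_mulVec_add B w)) (hne.image _)

/-- Any two linearly independent integer covectors give an upper bound for the lattice size, even
when they do not form a lattice basis. -/
lemma lsDelta2_le_of_det_ne_zero {Q : Set (Fin 2 → ℝ)} (hQ : IsCompact Q) (hne : Q.Nonempty)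
    (a b c d : ℤ) (hdet : a * d - b * c ≠ 0) :
    lsDelta2 Q ≤ latticeSupport Q (a + c) (b + d) + latticeSupport Q (-a) (-b)
      + latticeSupport Q (-c) (-d) := by
  obtain ⟨p0, p1, q0, q1, hu, hG⟩ := exists_unimodular_triangle_le (latticeSupport Q)
    (latticeSupport_sublinear hQ hne) _ (-a) (-b) (-(a + c)) (-(b + d))
    (by intro h0; apply hdet; linear_combination h0) le_rfl
  have hA : IsUnit (!![-p0, -p1; p0 - q0, p1 - q1] : Matrix (Fin 2) (Fin 2) ℤ).det := by
    rw [Matrix.det_fin_two_of]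
    convert hu using 1
    ring
  refine (lsDelta2_le hQ hne _ hA 0).trans ((lone2_le (hne.image _)
    (M := latticeSupport Q (-q0) (-q1)) (m0 := -latticeSupport Q p0 p1)
    (m1 := -latticeSupport Q (q0 - p0) (q1 - p1)) ?_ ?_ ?_).trans ?_)
  · rintro _ ⟨y, hy, rfl⟩
    have := le_latticeSupport hQ (-q0) (-q1) hy
    simp [zcast] at this ⊢
    linarith
  · rintro _ ⟨y, hy, rfl⟩
    have := le_latticeSupport hQ p0 p1 hy
    simp [zcast] at this ⊢
    linarith
  · rintro _ ⟨y, hy, rfl⟩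
    have := le_latticeSupport hQ (q0 - p0) (q1 - p1) hy
    simp [zcast] at this ⊢
    linarith
  · have e1 : -(a + c) - -a = -c := by ring
    have e2 : -(b + d) - -b = -d := by ring
    rw [e1, e2, neg_neg, neg_neg] at hG
    linarith

lemma lsDelta2_le_of_three {Q : Set (Fin 2 → ℝ)} (hQ : IsCompact Q) (hne : Q.Nonempty)
    (a b c d e f : ℤ) (hdet : a * d - b * c ≠ 0) :
    lsDelta2 Q ≤ latticeSupport Q (a + c + e) (b + d + f) + latticeSupport Q (-a) (-b)
      + latticeSupport Q (-c) (-d) + latticeSupport Q (-e) (-f) := by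
  have h1 := lsDelta2_le_of_det_ne_zero hQ hne a b c d hdet
  have h2 := latticeSupport_sublinear hQ hne 1 1 1 (a + c) (b + d) (a + c + e) (b + d + f) (-e) (-f)
    one_pos zero_le_one zero_le_one (by ring) (by ring)
  simp only [Int.cast_one, one_mul] at h2
  linarith

/-- The lattice size of a polytope is at least that of its slice in a coordinate hyperplane. -/
lemma lsDelta2_slice_le_lsDelta3 {P : Set (Fin 3 → ℝ)} (hP : IsCompact P) {Q : Set (Fin 2 → ℝ)}
    (hQ : IsCompact Q) (hne : Q.Nonempty) (hsub : ∀ y ∈ Q, ![0, y 0, y 1] ∈ P) :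
    lsDelta2 Q ≤ lsDelta3 P := by
  refine le_csInf ⟨_, 1, by simp, 0, rfl⟩ ?_
  rintro _ ⟨A, hA, v, rfl⟩
  obtain ⟨M, m0, m1, m2, hl, hb⟩ := exists_lone3_bounds (hP.image (continuous_mulVec_add A v))
  have hb' : ∀ y ∈ Q, _ := fun y hy => hb _ (Set.mem_image_of_mem _ (hsub y hy))
  simp [Matrix.mulVec, dotProduct, Fin.sum_univ_three, zcast] at hb'
  rw [hl]
  have s0 : latticeSupport Q (-A 0 1) (-A 0 2) ≤ v 0 - m0 := latticeSupport_le hne fun y hy => by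
    have := (hb' y hy).2.1
    push_cast; linarith
  have s1 : latticeSupport Q (-A 1 1) (-A 1 2) ≤ v 1 - m1 := latticeSupport_le hne fun y hy => by
    have := (hb' y hy).2.2.1
    push_cast; linarith
  have s2 : latticeSupport Q (-A 2 1) (-A 2 2) ≤ v 2 - m2 := latticeSupport_le hne fun y hy => by
    have := (hb' y hy).2.2.2
    push_cast; linarith
  have s3 : latticeSupport Q (A 0 1 + A 1 1 + A 2 1) (A 0 2 + A 1 2 + A 2 2) ≤
      M - v 0 - v 1 - v 2 := latticeSupport_le hne fun y hy => by
    have := (hb' y hy).1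
    push_cast; linarith
  by_cases h01 : A 0 1 * A 1 2 - A 0 2 * A 1 1 = 0
  · by_cases h02 : A 0 1 * A 2 2 - A 0 2 * A 2 1 = 0
    · by_cases h12 : A 1 1 * A 2 2 - A 1 2 * A 2 1 = 0
      · exfalso
        apply hA.ne_zero
        rw [Matrix.det_fin_three]
        linear_combination A 0 0 * h12 - A 1 0 * h02 + A 2 0 * h01
      · have := lsDelta2_le_of_three hQ hne (A 1 1) (A 1 2) (A 2 1) (A 2 2) (A 0 1) (A 0 2) h12
        rw [show A 1 1 + A 2 1 + A 0 1 = A 0 1 + A 1 1 + A 2 1 by ring,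
          show A 1 2 + A 2 2 + A 0 2 = A 0 2 + A 1 2 + A 2 2 by ring] at this
        linarith
    · have := lsDelta2_le_of_three hQ hne (A 0 1) (A 0 2) (A 2 1) (A 2 2) (A 1 1) (A 1 2) h02
      rw [show A 0 1 + A 2 1 + A 1 1 = A 0 1 + A 1 1 + A 2 1 by ring,
        show A 0 2 + A 2 2 + A 1 2 = A 0 2 + A 1 2 + A 2 2 by ring] at this
      linarith
  · have := lsDelta2_le_of_three hQ hne (A 0 1) (A 0 2) (A 1 1) (A 1 2) (A 2 1) (A 2 2) h01
    linarith

lemma le_of_mem_convexHull {E : Type*} [AddCommGroup E] [Module ℝ E] {V : Set E} {f : E → ℝ}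
    (hf : IsLinearMap ℝ f) {c : ℝ} (hV : ∀ x ∈ V, f x ≤ c) {x : E} (hx : x ∈ convexHull ℝ V) :
    f x ≤ c :=
  convexHull_min (t := {x | f x ≤ c}) hV (convex_halfSpace_le hf c) hx

lemma isLinearMap_two (a b : ℝ) : IsLinearMap ℝ fun y : Fin 2 → ℝ => a * y 0 + b * y 1 :=
  ⟨fun x y => by simp only [Pi.add_apply]; ring,
    fun c x => by simp only [Pi.smul_apply, smul_eq_mul]; ring⟩

lemma isLinearMap_three (a b c : ℝ) :
    IsLinearMap ℝ fun y : Fin 3 → ℝ => a * y 0 + b * y 1 + c * y 2 :=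
  ⟨fun x y => by simp only [Pi.add_apply]; ring,
    fun c x => by simp only [Pi.smul_apply, smul_eq_mul]; ring⟩

lemma exists_gt_of_mem_interior {Q : Set (Fin 2 → ℝ)} {q : Fin 2 → ℝ} (hq : q ∈ interior Q)
    {a b : ℝ} (hab : 0 < a * a + b * b) :
    ∃ y ∈ Q, a * q 0 + b * q 1 < a * y 0 + b * y 1 := by
  have hcont : Filter.Tendsto (fun t : ℝ => q + t • ![a, b]) (nhdsWithin 0 (Set.Ioi 0))
      (nhds q) := by
    have : Continuous fun t : ℝ => q + t • ![a, b] := by fun_prop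
    simpa using (this.tendsto 0).mono_left nhdsWithin_le_nhds
  obtain ⟨t, ht, ht0⟩ := ((hcont.eventually (mem_interior_iff_mem_nhds.1 hq)).and
    self_mem_nhdsWithin).exists
  refine ⟨_, ht, ?_⟩
  have := mul_pos (Set.mem_Ioi.1 ht0) hab
  simp
  linarith

/-- An integer functional at an interior lattice point of the slice `x 0 = 0` of a lattice polytope
lies at least one below its maximum on the slice. -/
lemma add_one_le_of_mem_interior_slice {P : Set (Fin 3 → ℝ)} (hP : IsLatticePolytope P)
    (hslab : ∀ x ∈ P, 0 ≤ x 0 ∧ x 0 ≤ 1) {a b : ℤ} (hab : 0 < a * a + b * b) {c : ℝ}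
    (hc : ∀ x ∈ P, x 0 = 0 → a * x 1 + b * x 2 ≤ c) {q : Fin 2 → ℝ}
    (hq : q ∈ interior ((fun x => ![x 1, x 2]) '' (P ∩ {x | x 0 = 0})))
    (hqZ : ∀ i, ∃ n : ℤ, q i = n) : a * q 0 + b * q 1 + 1 ≤ c := by
  obtain ⟨V, -, hVZ, rfl⟩ := hP
  obtain ⟨y, ⟨x, ⟨hx, hx0⟩, rfl⟩, hlt⟩ := exists_gt_of_mem_interior hq
    (a := (a : ℝ)) (b := (b : ℝ)) (by exact_mod_cast hab)
  simp only [Matrix.cons_val_zero, Matrix.cons_val_one, Set.mem_ofPred_eq] at hlt hx0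
  obtain ⟨n0, hn0⟩ := hqZ 0
  obtain ⟨n1, hn1⟩ := hqZ 1
  obtain ⟨w, hwV, hw0, hw⟩ : ∃ w ∈ V, w 0 = 0 ∧ a * q 0 + b * q 1 < a * w 1 + b * w 2 := by
    by_contra! hcon
    obtain ⟨K, hK⟩ := (V.finite_toSet.image fun w : Fin 3 → ℝ => (a : ℝ) * w 1 + b * w 2).bddAbove
    have key := le_of_mem_convexHull
      (isLinearMap_three (-(K - (a * q 0 + b * q 1))) a b) (c := a * q 0 + b * q 1) ?_ hx
    · simp only [hx0] at key
      linarith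
    intro w hw
    obtain ⟨n, hn⟩ := hVZ w hw 0
    obtain ⟨hl, hr⟩ := hslab w (subset_convexHull ℝ _ hw)
    rw [hn] at hl hr
    have hl' : 0 ≤ n := by exact_mod_cast hl
    have hr' : n ≤ 1 := by exact_mod_cast hr
    obtain rfl | rfl : n = 0 ∨ n = 1 := by omega
    · have := hcon w hw (by simpa using hn)
      simp only [hn, Int.cast_zero]
      linarith
    · have : (a : ℝ) * w 1 + b * w 2 ≤ K := hK ⟨w, hw, rfl⟩
      simp only [hn, Int.cast_one]
      linarith
  have hwc := hc w (subset_convexHull ℝ _ hwV) hw0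
  obtain ⟨k1, hk1⟩ := hVZ w hwV 1
  obtain ⟨k2, hk2⟩ := hVZ w hwV 2
  rw [hk1, hk2] at hw hwc
  rw [hn0, hn1] at hw ⊢
  have hw' : a * n0 + b * n1 < a * k1 + b * k2 := by exact_mod_cast hw
  have hw'' : (a : ℝ) * n0 + b * n1 + 1 ≤ a * k1 + b * k2 := by exact_mod_cast hw'
  linarith

theorem lsDelta3_width_one_interior (P : Set (Fin 3 → ℝ)) (hP : IsLatticePolytope P)
    (hslab : ∀ x ∈ P, 0 ≤ x 0 ∧ x 0 ≤ 1)
    (h0 : (P ∩ {x | x 0 = 0}).Nonempty) (h1 : (P ∩ {x | x 0 = 1}).Nonempty)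
    (B0 B1 : Set (Fin 2 → ℝ))
    (hB0 : B0 = (fun x => ![x 1, x 2]) '' (P ∩ {x | x 0 = 0}))
    (hB1 : B1 = (fun x => ![x 1, x 2]) '' (P ∩ {x | x 0 = 1}))
    (hsub : ∃ t : Fin 2 → ℤ, (fun y => y + zcast t) '' B1 ⊆
      convexHull ℝ {p : Fin 2 → ℝ | p ∈ interior B0 ∧ ∀ i, ∃ n : ℤ, p i = (n : ℝ)}) :
    lsDelta3 P = lsDelta2 B0 := by
  obtain ⟨t, ht⟩ := hsub
  have hlat := hP
  obtain ⟨V, hVne, hVZ, hPV⟩ := hP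
  have hPc : IsCompact P := hPV ▸ V.finite_toSet.isCompact_convexHull (𝕜 := ℝ)
  have hB0c : IsCompact B0 := by
    rw [hB0]
    refine (hPc.inter_right (isClosed_eq (by fun_prop) (by fun_prop))).image ?_
    fun_prop
  have hB0ne : B0.Nonempty := hB0 ▸ h0.image _
  have hPne : P.Nonempty := h0.mono Set.inter_subset_left
  have memB0 : ∀ x ∈ P, x 0 = 0 → ![x 1, x 2] ∈ B0 := fun x hx hx0 =>
    hB0 ▸ Set.mem_image_of_mem _ ⟨hx, hx0⟩
  apply le_antisymm
  · refine le_csInf ⟨_, 1, by simp, 0, rfl⟩ ?_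
    rintro _ ⟨A, hA, v, rfl⟩
    obtain ⟨M, m0, m1, hl, hb⟩ := exists_lone2_bounds (hB0c.image (continuous_mulVec_add A v))
    have hb' : ∀ y ∈ B0, _ := fun y hy => hb _ (Set.mem_image_of_mem _ hy)
    simp [zcast] at hb'
    have hrow : 0 < (A 0 0 + A 1 0) * (A 0 0 + A 1 0) + (A 0 1 + A 1 1) * (A 0 1 + A 1 1) := by
      by_contra hcon
      have z0 : A 0 0 + A 1 0 = 0 := by nlinarith
      have z1 : A 0 1 + A 1 1 = 0 := by nlinarith
      apply hA.ne_zero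
      rw [Matrix.det_fin_two]
      linear_combination A 1 1 * z0 - A 1 0 * z1
    have hint : ∀ x ∈ P, x 0 = 1 →
        (A 0 0 + A 1 0) * (x 1 + t 0) + (A 0 1 + A 1 1) * (x 2 + t 1) + 1 ≤ M - v 0 - v 1 ∧
        m0 - v 0 ≤ A 0 0 * (x 1 + t 0) + A 0 1 * (x 2 + t 1) ∧
        m1 - v 1 ≤ A 1 0 * (x 1 + t 0) + A 1 1 * (x 2 + t 1) := by
      intro x hx hx1
      have hmem := ht ⟨![x 1, x 2], hB1 ▸ Set.mem_image_of_mem _ ⟨hx, hx1⟩, rfl⟩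
      refine ⟨?_, ?_, ?_⟩
      · have := le_of_mem_convexHull (isLinearMap_two (A 0 0 + A 1 0) (A 0 1 + A 1 1))
          (c := M - v 0 - v 1 - 1) ?_ hmem
        · simp [zcast] at this
          linarith
        rintro q ⟨hq, hqZ⟩
        have := add_one_le_of_mem_interior_slice hlat hslab hrow (c := M - v 0 - v 1)
          (fun x hx hx0 => by
            have := (hb' _ (memB0 x hx hx0)).1
            simp at this
            push_cast
            linarith) (hB0 ▸ hq) hqZ
        push_cast at this
        linarith
      · have := le_of_mem_convexHull (isLinearMap_two (-A 0 0) (-A 0 1))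
          (c := v 0 - m0) ?_ hmem
        · simp [zcast] at this
          linarith
        rintro q ⟨hq, -⟩
        have := (hb' q (interior_subset hq)).2.1
        linarith
      · have := le_of_mem_convexHull (isLinearMap_two (-A 1 0) (-A 1 1))
          (c := v 1 - m1) ?_ hmem
        · simp [zcast] at this
          linarith
        rintro q ⟨hq, -⟩
        have := (hb' q (interior_subset hq)).2.2
        linarith
    have hvert : ∀ w ∈ V, w 0 = 0 ∨ w 0 = 1 := by
      intro w hw
      obtain ⟨n, hn⟩ := hVZ w hw 0
      obtain ⟨hl, hr⟩ := hslab w (hPV ▸ subset_convexHull ℝ _ hw)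
      rw [hn] at hl hr ⊢
      have hl' : 0 ≤ n := by exact_mod_cast hl
      have hr' : n ≤ 1 := by exact_mod_cast hr
      obtain rfl | rfl : n = 0 ∨ n = 1 := by omega
      · simp
      · simp
    have extend : ∀ a b d c : ℝ,
        (∀ x ∈ P, x 0 = 0 → b * x 1 + d * x 2 ≤ c) →
        (∀ x ∈ P, x 0 = 1 → a + b * x 1 + d * x 2 ≤ c) →
        ∀ x ∈ P, a * x 0 + b * x 1 + d * x 2 ≤ c := by
      intro a b d c hz ho x hx
      rw [hPV] at hx
      refine le_of_mem_convexHull (isLinearMap_three a b d) (fun w hw => ?_) hx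
      have hwP : w ∈ P := hPV ▸ subset_convexHull ℝ _ hw
      rcases hvert w hw with h | h
      · have := hz w hwP h
        simp only [h]; linarith
      · have := ho w hwP h
        simp only [h]; linarith
    obtain ⟨B, hB⟩ : ∃ B : Matrix (Fin 3) (Fin 3) ℤ, B = !![1, 0, 0;
        A 0 0 * t 0 + A 0 1 * t 1, A 0 0, A 0 1; A 1 0 * t 0 + A 1 1 * t 1, A 1 0, A 1 1] :=
      ⟨_, rfl⟩
    have hBdet : IsUnit B.det := by
      rw [Matrix.det_fin_two] at hA
      convert hA using 1
      rw [hB, Matrix.det_fin_three]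
      simp
    refine (lsDelta3_le hPc hPne B hBdet ![0, v 0, v 1]).trans ?_
    rw [hl, show M - m0 - m1 = M - 0 - m0 - m1 by ring]
    apply lone3_le (hPne.image _)
    · rintro _ ⟨x, hx, rfl⟩
      have := extend (1 + (A 0 0 + A 1 0) * t 0 + (A 0 1 + A 1 1) * t 1) (A 0 0 + A 1 0)
        (A 0 1 + A 1 1) (M - v 0 - v 1)
        (fun x hx hx0 => by
          have := (hb' _ (memB0 x hx hx0)).1
          simp at this
          linarith)
        (fun x hx hx1 => by linarith [(hint x hx hx1).1]) x hx
      simp [hB, Matrix.mulVec, dotProduct, Fin.sum_univ_three, zcast]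
      linarith
    · rintro _ ⟨x, hx, rfl⟩
      have := (hslab x hx).1
      simpa [hB, Matrix.mulVec, dotProduct, Fin.sum_univ_three, zcast] using this
    · rintro _ ⟨x, hx, rfl⟩
      have := extend (-(A 0 0 * t 0 + A 0 1 * t 1)) (-A 0 0) (-A 0 1) (v 0 - m0)
        (fun x hx hx0 => by
          have := (hb' _ (memB0 x hx hx0)).2.1
          simp at this
          linarith)
        (fun x hx hx1 => by linarith [(hint x hx hx1).2.1]) x hx
      simp [hB, Matrix.mulVec, dotProduct, Fin.sum_univ_three, zcast]
      linarith
    · rintro _ ⟨x, hx, rfl⟩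
      have := extend (-(A 1 0 * t 0 + A 1 1 * t 1)) (-A 1 0) (-A 1 1) (v 1 - m1)
        (fun x hx hx0 => by
          have := (hb' _ (memB0 x hx hx0)).2.2
          simp at this
          linarith)
        (fun x hx hx1 => by linarith [(hint x hx hx1).2.2]) x hx
      simp [hB, Matrix.mulVec, dotProduct, Fin.sum_univ_three, zcast]
      linarith
  · refine lsDelta2_slice_le_lsDelta3 hPc hB0c hB0ne ?_
    rw [hB0]
    rintro _ ⟨x, ⟨hx, hx0⟩, rfl⟩
    convert hx using 1
    ext i
    fin_cases i
    · exact Eq.symm hx0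
    · rfl
    · rfl
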